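/- Let 0 < p < 1 and let (Φ_n)_{n≥1} be any nondecreasing sequence of positive reals with lim_{n→∞} Φ_n = +∞. Then there exists one martingale f ∈ H_p(G_m) satisfying simultaneously: Σ_{k=1}^∞ |f̂(k)|^p Φ_k / k^{2−p} = ∞, Σ_{k=1}^∞ (Φ_{M_k} / M_k^{2/p−2}) Σ_{j=1}^{m_k−1} |f̂(j·M_k)|^2 = ∞, and Σ_{k=1}^∞ ‖S_k f‖_{L_{p,∞}}^p Φ_k / k^{2−p} = ∞. -/

import Mathlib

open MeasureTheory Filter Finset
open scoped Classical ENNReal NNReal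

noncomputable section

namespace VilenkinPaper

/-- The generalized powers `M_0 = 1`, `M_{k+1} = m_k M_k`. -/
def Mseq (m : ℕ → ℕ) : ℕ → ℕ
  | 0 => 1
  | k + 1 => m k * Mseq m k

/-- The Vilenkin group `G_m = ∏_k ℤ_{m_k}`. -/
abbrev Gm (m : ℕ → ℕ) : Type := (k : ℕ) → ZMod (m k)

/-- The `j`-th digit of `n` in the generalized number system based on `m`. -/
def digit (m : ℕ → ℕ) (n j : ℕ) : ℕ := n / Mseq m j % m j

/-- The generalized Rademacher functions `r_k(x) = exp(2πi x_k / m_k)`. -/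
def rad (m : ℕ → ℕ) (k : ℕ) (x : Gm m) : ℂ :=
  Complex.exp (2 * Real.pi * Complex.I * ((x k).val : ℂ) / (m k : ℂ))

/-- The Vilenkin system `ψ_n = ∏_k r_k^{n_k}`. -/
def psi (m : ℕ → ℕ) (n : ℕ) (x : Gm m) : ℂ := ∏ᶠ k : ℕ, rad m k x ^ digit m n k

/-- The Dirichlet kernels `D_n = ∑_{k<n} ψ_k`. -/
def Dker (m : ℕ → ℕ) (n : ℕ) (x : Gm m) : ℂ := ∑ k ∈ Finset.range n, psi m k x

/-- The interval `I_n(x)` : all `y` agreeing with `x` on the first `n` coordinates. -/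
def Iset (m : ℕ → ℕ) (n : ℕ) (x : Gm m) : Set (Gm m) := {y | ∀ k < n, y k = x k}

/-- `I_n := I_n(0)`. -/
def IsetO (m : ℕ → ℕ) (n : ℕ) : Set (Gm m) := Iset m n 0

/-- `μ` is the normalized Haar (product) measure iff every interval `I_n(x)` has
measure `1 / M_n`. -/
def IsHaarGm (m : ℕ → ℕ) (μ : Measure (Gm m)) : Prop :=
  ∀ n x, μ (Iset m n x) = ((Mseq m n : ℝ≥0∞))⁻¹

/-- The σ-algebra `F_n` generated by the intervals `{I_n(x)}`, i.e. by the first `n`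
coordinates. -/
def filt (m : ℕ → ℕ) (n : ℕ) : MeasurableSpace (Gm m) :=
  MeasurableSpace.comap (fun x (k : Fin n) => x k) ⊤

/-- A (Vilenkin) martingale with respect to the filtration `F_n`. -/
def IsVMartingale (m : ℕ → ℕ) (μ : Measure (Gm m)) (f : ℕ → Gm m → ℂ) : Prop :=
  (∀ n, Integrable (f n) μ) ∧
  (∀ n, Measurable[filt m n] (f n)) ∧
  (∀ n N, n ≤ N → μ[f N | filt m n] =ᵐ[μ] f n)

/-- Membership in the martingale Hardy space `H_p`: the maximal function
`f* = sup_n |f^{(n)}|` belongs to `L_p`. -/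
def MemHp (m : ℕ → ℕ) (μ : Measure (Gm m)) (p : ℝ) (f : ℕ → Gm m → ℂ) : Prop :=
  ∫⁻ x, (⨆ n, (‖f n x‖₊ : ℝ≥0∞)) ^ p ∂μ < ⊤

/-- The `i`-th Vilenkin–Fourier coefficient of an integrable function. -/
def fourierCoefFn (m : ℕ → ℕ) (μ : Measure (Gm m)) (g : Gm m → ℂ) (i : ℕ) : ℂ :=
  ∫ x, g x * (starRingEnd ℂ) (psi m i x) ∂μ

/-- The partial sum `S_n` built from a sequence `c` of Fourier coefficients. -/
def Spart (m : ℕ → ℕ) (c : ℕ → ℂ) (n : ℕ) (x : Gm m) : ℂ :=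
  ∑ k ∈ Finset.range n, c k * psi m k x

/-- The weak `L_{p,∞}` quasinorm `sup_{λ>0} λ μ(|g| > λ)^{1/p}`. -/
def wLp (m : ℕ → ℕ) (μ : Measure (Gm m)) (p : ℝ) (g : Gm m → ℂ) : ℝ≥0∞ :=
  ⨆ (t : ℝ) (_ : 0 < t), ENNReal.ofReal t * μ {x | t < ‖g x‖} ^ (1 / p)

/-- `|n| = max {j : n_j ≠ 0}`. -/
def maxDigit (m : ℕ → ℕ) (n : ℕ) : ℕ := sSup {j | digit m n j ≠ 0}

/-- The set `ℕ_{n_0}` of positive integers with `n_0 = n_{|n|} = 1`. -/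
def Nn0 (m : ℕ → ℕ) : Set ℕ :=
  {n | 0 < n ∧ digit m n 0 = 1 ∧ digit m n (maxDigit m n) = 1}

/-- The atom `a = (M_α^{1/p-1}/M) (D_{M_{α+1}} - D_{M_α})`. -/
def atomFun (m : ℕ → ℕ) (MM : ℕ) (p : ℝ) (a : ℕ) (x : Gm m) : ℂ :=
  (((Mseq m a : ℝ) ^ (1 / p - 1) / (MM : ℝ) : ℝ) : ℂ) *
    (Dker m (Mseq m (a + 1)) x - Dker m (Mseq m a) x)

/-- The coefficients `λ_k = Φ_{M_{α_k}}^{-1/4}`. -/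
def lamSeq (m : ℕ → ℕ) (Φ : ℕ → ℝ) (α : ℕ → ℕ) (k : ℕ) : ℝ :=
  Φ (Mseq m (α k)) ^ (-(1 / 4 : ℝ))

/-- The martingale `f^{(A)} = ∑_{k : α_k < A} λ_k a_k` of the counterexample construction. -/
def fCon (m : ℕ → ℕ) (MM : ℕ) (p : ℝ) (Φ : ℕ → ℝ) (α : ℕ → ℕ) (A : ℕ) (x : Gm m) : ℂ :=
  ∑ᶠ (k : ℕ) (_ : α k < A), (lamSeq m Φ α k : ℂ) * atomFun m MM p (α k) x

/-! ### The generalized number system -/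

lemma Mseq_pos {m : ℕ → ℕ} (hm : ∀ k, 2 ≤ m k) (k : ℕ) : 0 < Mseq m k := by
  induction k with
  | zero => simp [Mseq]
  | succ k ih => exact Nat.mul_pos (by linarith [hm k]) ih

lemma Mseq_strictMono {m : ℕ → ℕ} (hm : ∀ k, 2 ≤ m k) : StrictMono (Mseq m) := by
  refine strictMono_nat_of_lt_succ fun k => ?_
  have h1 := Mseq_pos hm k
  have h2 := hm k
  show Mseq m k < m k * Mseq m k
  nlinarith

lemma digit_eq_zero_of_lt {m : ℕ → ℕ} {n j : ℕ} (h : n < Mseq m j) : digit m n j = 0 := by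
  simp [digit, Nat.div_eq_of_lt h]

lemma digit_eq_zero {m : ℕ → ℕ} (hm : ∀ k, 2 ≤ m k) {n b j : ℕ} (h : n < Mseq m b)
    (hj : b ≤ j) : digit m n j = 0 :=
  digit_eq_zero_of_lt (h.trans_le ((Mseq_strictMono hm).monotone hj))

lemma exists_Mseq_le_lt {m : ℕ → ℕ} (hm : ∀ k, 2 ≤ m k) {n : ℕ} (hn : 0 < n) :
    ∃ k, Mseq m k ≤ n ∧ n < Mseq m (k + 1) := by
  have hex : ∃ k, n < Mseq m k := ⟨n + 1, (Nat.lt_succ_self n).trans_le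
    ((Mseq_strictMono hm).id_le (n + 1))⟩
  have h0 : Nat.find hex ≠ 0 := by
    intro h
    have := Nat.find_spec hex
    rw [h] at this
    simp [Mseq] at this
    omega
  obtain ⟨k, hk⟩ := Nat.exists_eq_succ_of_ne_zero h0
  refine ⟨k, not_lt.1 (Nat.find_min hex (by omega)), ?_⟩
  have := Nat.find_spec hex
  rwa [hk] at this

lemma digit_leading {m : ℕ → ℕ} {n k : ℕ} (h : n < Mseq m (k + 1)) :
    digit m n k = n / Mseq m k :=
  Nat.mod_eq_of_lt (Nat.div_lt_of_lt_mul (by rwa [mul_comm]))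

/-! ### The Vilenkin system -/

lemma norm_rad (m : ℕ → ℕ) (k : ℕ) (x : Gm m) : ‖rad m k x‖ = 1 := by
  have : 2 * (Real.pi : ℂ) * Complex.I * ((x k).val : ℂ) / (m k : ℂ)
      = ((2 * Real.pi * (x k).val / m k : ℝ) : ℂ) * Complex.I := by push_cast; ring
  rw [rad, this, Complex.norm_exp_ofReal_mul_I]

lemma norm_psi (m : ℕ → ℕ) (n : ℕ) (x : Gm m) : ‖psi m n x‖ = 1 :=
  finprod_induction (fun z : ℂ => ‖z‖ = 1) (by simp) (fun a b ha hb => by simp [ha, hb])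
    (fun k => by simp [norm_rad])

lemma psi_congr {m : ℕ → ℕ} (hm : ∀ k, 2 ≤ m k) {n N : ℕ} (hn : n < Mseq m N) {x y : Gm m}
    (h : ∀ k < N, x k = y k) : psi m n x = psi m n y := by
  refine finprod_congr fun k => ?_
  rcases lt_or_ge k N with hk | hk
  · simp [rad, h k hk]
  · simp [digit_eq_zero hm hn hk]

lemma psi_eq_one {m : ℕ → ℕ} (hm : ∀ k, 2 ≤ m k) {n N : ℕ} (hn : n < Mseq m N) {x : Gm m}
    (hx : x ∈ IsetO m N) : psi m n x = 1 := by
  rw [psi_congr hm hn hx, psi]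
  simp [rad]

lemma rad_add_single {m : ℕ → ℕ} (hm : ∀ k, 2 ≤ m k) (k j : ℕ) (x : Gm m) :
    rad m j (x + Pi.single k 1) =
      rad m j x * if j = k then Complex.exp (2 * Real.pi * Complex.I / (m k : ℂ)) else 1 := by
  split_ifs with h
  · subst h
    have : NeZero (m j) := ⟨by linarith [hm j]⟩
    have : Fact (1 < m j) := ⟨hm j⟩
    have hv (z : ZMod (m j)) : Complex.exp (2 * Real.pi * Complex.I * (z.val : ℂ) / (m j : ℂ))
        = ZMod.stdAddChar z := by
      rw [ZMod.stdAddChar_apply, ZMod.toCircle_apply]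
    have h1 : Complex.exp (2 * Real.pi * Complex.I / (m j : ℂ))
        = ZMod.stdAddChar (1 : ZMod (m j)) := by
      rw [← hv, ZMod.val_one]; simp
    rw [rad, rad, hv, hv, h1, ← AddChar.map_add_eq_mul]
    simp
  · simp [rad, h]

lemma psi_add_single {m : ℕ → ℕ} (hm : ∀ k, 2 ≤ m k) (n k : ℕ) (x : Gm m) :
    psi m n (x + Pi.single k 1) =
      psi m n x * Complex.exp (2 * Real.pi * Complex.I / (m k : ℂ)) ^ digit m n k := by
  obtain ⟨N, hN⟩ : ∃ N, n < Mseq m N := ⟨n + 1, (Nat.lt_succ_self n).trans_le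
    ((Mseq_strictMono hm).id_le (n + 1))⟩
  have hfin (g : ℕ → ℂ) : Function.HasFiniteMulSupport fun j => g j ^ digit m n j := by
    refine (Set.finite_Iio N).subset fun j hj => ?_
    by_contra hjN
    exact hj (by simp [digit_eq_zero hm hN (not_lt.1 hjN)])
  simp only [psi, rad_add_single hm, mul_pow]
  rw [finprod_mul_distrib (hfin _) (hfin _)]
  congr 1
  rw [finprod_eq_single _ k fun j hj => by simp [hj]]
  simp

/-! ### The Haar measure -/

lemma IsHaarGm.isProbabilityMeasure {m : ℕ → ℕ} {μ : Measure (Gm m)} (hμ : IsHaarGm m μ) :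
    IsProbabilityMeasure μ :=
  ⟨by simpa [Iset, Mseq] using hμ 0 0⟩

lemma filt_le {m : ℕ → ℕ} (hm : ∀ k, 2 ≤ m k) (n : ℕ) :
    filt m n ≤ (inferInstance : MeasurableSpace (Gm m)) := by
  have (k : ℕ) : NeZero (m k) := ⟨by linarith [hm k]⟩
  rintro _ ⟨t, -, rfl⟩
  have hpi : Measurable fun (x : Gm m) (k : Fin n) => x k :=
    measurable_pi_lambda _ fun k => measurable_pi_apply _
  exact hpi t.toFinite.measurableSet

lemma measurableSet_filt_IsetO (m : ℕ → ℕ) {n b : ℕ} (h : b ≤ n) :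
    MeasurableSet[filt m n] (IsetO m b) := by
  refine ⟨{y | ∀ k : Fin n, (k : ℕ) < b → y k = 0}, trivial, ?_⟩
  ext x
  exact ⟨fun hx k hk => hx ⟨k, hk.trans_le h⟩ hk, fun hx k hk => hx k hk⟩

lemma measurableSet_IsetO {m : ℕ → ℕ} (hm : ∀ k, 2 ≤ m k) (b : ℕ) :
    MeasurableSet (IsetO m b) :=
  filt_le hm b _ (measurableSet_filt_IsetO m le_rfl)

lemma integral_add_single {m : ℕ → ℕ} (hm : ∀ k, 2 ≤ m k) {μ : Measure (Gm m)}
    (hμ : IsHaarGm m μ) {N : ℕ} {g : Gm m → ℂ}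
    (hg : ∀ x y : Gm m, (∀ k < N, x k = y k) → g x = g y) (k : Fin N) :
    ∫ x, g (x + Pi.single (k : ℕ) 1) ∂μ = ∫ x, g x ∂μ := by
  have (k : ℕ) : NeZero (m k) := ⟨by linarith [hm k]⟩
  have := hμ.isProbabilityMeasure
  let r : Gm m → ((k : Fin N) → ZMod (m k)) := fun x k => x k
  let e : ((k : Fin N) → ZMod (m k)) → Gm m := fun y k => if h : k < N then y ⟨k, h⟩ else 0
  have hr : Measurable r := measurable_pi_lambda _ fun k => measurable_pi_apply _
  have her (x : Gm m) (k : ℕ) (hk : k < N) : e (r x) k = x k := by simp [e, r, hk]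
  have hν (y) : (μ.map r).real {y} = ((Mseq m N : ℝ≥0∞)⁻¹).toReal := by
    rw [measureReal_def, Measure.map_apply hr (measurableSet_singleton y), ← hμ N (e y)]
    congr 2
    ext x
    simp only [Set.mem_preimage, Set.mem_singleton_iff, Iset, Set.mem_ofPred_eq]
    constructor
    · rintro rfl k hk
      exact (her x k hk).symm
    · intro h
      ext k
      simpa [r, e] using h k k.2
  have hint (h : Gm m → ℂ) (hh : ∀ x y : Gm m, (∀ k < N, x k = y k) → h x = h y) :
      ∫ x, h x ∂μ = ∑ y, ((Mseq m N : ℝ≥0∞)⁻¹).toReal • h (e y) := by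
    have h1 : ∫ x, h x ∂μ = ∫ x, (h ∘ e) (r x) ∂μ :=
      integral_congr_ae (.of_forall fun x => hh _ _ fun k hk => (her x k hk).symm)
    rw [h1, ← integral_map hr.aemeasurable
      (Measurable.of_discrete (f := h ∘ e)).aestronglyMeasurable, integral_fintype]
    · simp [hν]
    · have := Measure.isProbabilityMeasure_map (μ := μ) hr.aemeasurable
      exact .of_finite
  rw [hint g hg]
  refine (hint (fun x => g (x + Pi.single (k : ℕ) 1))
    fun x y h => hg _ _ fun j hj => by simp [h j hj]).trans ?_
  rw [← Equiv.sum_comp (Equiv.addRight (Pi.single k 1 : (k : Fin N) → ZMod (m k)))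
    fun y => ((Mseq m N : ℝ≥0∞)⁻¹).toReal • g (e y)]
  refine Finset.sum_congr rfl fun y _ => ?_
  congr 1
  refine hg _ _ fun j hj => ?_
  by_cases hjk : j = k
  · subst hjk; simp [e]
  · have : (⟨j, hj⟩ : Fin N) ≠ k := fun h => hjk (by rw [← h])
    simp [e, hj, hjk, this]

/-! ### Normalized indicators of the intervals `I_b` -/

/-- The function `M_b 1_{I_b}`, which is the Dirichlet kernel `D_{M_b}`. -/
def intervalKernel (m : ℕ → ℕ) (b : ℕ) : Gm m → ℂ :=
  (IsetO m b).indicator fun _ => (Mseq m b : ℂ)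

lemma measurable_filt_intervalKernel (m : ℕ → ℕ) {n b : ℕ} (h : b ≤ n) :
    Measurable[filt m n] (intervalKernel m b) :=
  Measurable.indicator (m := filt m n) (@measurable_const _ _ _ (filt m n) _)
    (measurableSet_filt_IsetO m h)

lemma integrable_intervalKernel {m : ℕ → ℕ} (hm : ∀ k, 2 ≤ m k) {μ : Measure (Gm m)}
    [IsFiniteMeasure μ] (b : ℕ) : Integrable (intervalKernel m b) μ :=
  (integrable_const _).indicator (measurableSet_IsetO hm b)

lemma setIntegral_intervalKernel {m : ℕ → ℕ} (hm : ∀ k, 2 ≤ m k) {μ : Measure (Gm m)}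
    (hμ : IsHaarGm m μ) {n b : ℕ} (h : n ≤ b) {s : Set (Gm m)}
    (hs : MeasurableSet[filt m n] s) :
    ∫ x in s, intervalKernel m b x ∂μ = if (0 : Gm m) ∈ s then 1 else 0 := by
  have hM : (Mseq m b : ℂ) ≠ 0 := by exact_mod_cast (Mseq_pos hm b).ne'
  have hreal : μ.real (IsetO m b) = (Mseq m b : ℝ)⁻¹ := by
    simp [measureReal_def, IsetO, hμ b 0]
  rw [intervalKernel, setIntegral_indicator (measurableSet_IsetO hm b), setIntegral_const]
  obtain ⟨t, -, rfl⟩ := hs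
  have hmem {x : Gm m} (hx : x ∈ IsetO m b) :
      (fun k : Fin n => x k) = fun k : Fin n => (0 : Gm m) k :=
    funext fun k => hx k (k.2.trans_le h)
  split_ifs with h0
  · rw [Set.inter_eq_right.2 fun x hx => ?_, hreal]
    · simp [hM]
    · simpa [Set.mem_preimage, hmem hx] using h0
  · have : ((fun (x : Gm m) (k : Fin n) => x k) ⁻¹' t) ∩ IsetO m b = ∅ := by
      ext x
      simp only [Set.mem_inter_iff, Set.mem_preimage, Set.mem_empty_iff_false, iff_false, not_and]
      intro hx hxb
      rw [hmem hxb] at hx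
      exact h0 hx
    simp [this]

lemma fourierCoefFn_intervalKernel {m : ℕ → ℕ} (hm : ∀ k, 2 ≤ m k) {μ : Measure (Gm m)}
    (hμ : IsHaarGm m μ) (b i : ℕ) :
    fourierCoefFn m μ (intervalKernel m b) i = if i < Mseq m b then 1 else 0 := by
  split_ifs with hi
  · have h1 : ∀ x, intervalKernel m b x * (starRingEnd ℂ) (psi m i x) = intervalKernel m b x := by
      intro x
      by_cases hx : x ∈ IsetO m b
      · simp [psi_eq_one hm hi hx]
      · simp [intervalKernel, hx]
    have h2 := setIntegral_intervalKernel hm hμ (Nat.zero_le b)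
      (s := Set.univ) (@MeasurableSet.univ _ (filt m 0))
    simpa [fourierCoefFn, h1] using h2
  · rw [not_lt] at hi
    obtain ⟨k, hk, hk'⟩ := exists_Mseq_le_lt hm ((Mseq_pos hm b).trans_le hi)
    have hbk : b ≤ k := Nat.lt_succ_iff.1 ((Mseq_strictMono hm).lt_iff_lt.1 (hi.trans_lt hk'))
    set z := Complex.exp (2 * Real.pi * Complex.I / (m k : ℂ)) ^ digit m i k with hz
    have hz1 : z ≠ 1 := by
      have hprim := Complex.isPrimitiveRoot_exp (m k) (by linarith [hm k])
      refine hprim.pow_ne_one_of_pos_of_lt ?_ (Nat.mod_lt _ (by linarith [hm k]))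
      rw [digit_leading hk']
      exact (Nat.div_pos hk (Mseq_pos hm k)).ne'
    have hker (x y : Gm m) (h : ∀ j < b, x j = y j) :
        intervalKernel m b x = intervalKernel m b y := by
      have : x ∈ IsetO m b ↔ y ∈ IsetO m b :=
        forall₂_congr fun j hj => by rw [h j hj]
      simp [intervalKernel, Set.indicator, this]
    have key := integral_add_single hm hμ (N := k + 1)
      (g := fun x => intervalKernel m b x * (starRingEnd ℂ) (psi m i x))
      (fun x y h => by
        rw [hker x y fun j hj => h j (by omega), psi_congr hm hk' h]) (Fin.last k)
    have hshift (x : Gm m) : intervalKernel m b (x + Pi.single k 1) = intervalKernel m b x :=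
      hker _ _ fun j hj => by simp [show j ≠ k by omega]
    simp only [Fin.val_last, hshift, psi_add_single hm, map_mul, ← hz, ← mul_assoc] at key
    rw [integral_mul_const] at key
    have hz2 : (starRingEnd ℂ) z - 1 ≠ 0 := fun h => hz1 (by
      have := congrArg (starRingEnd ℂ) (sub_eq_zero.1 h)
      simpa using this)
    exact (mul_eq_zero.1 (show fourierCoefFn m μ (intervalKernel m b) i *
      ((starRingEnd ℂ) z - 1) = 0 by rw [fourierCoefFn, mul_sub, key]; ring)).resolve_right hz2

/-! ### The martingale with coefficients constant on the blocks `[M_b, M_{b+1})` -/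

/-- The martingale `∑_b w_b (D_{M_{b+1}} - D_{M_b})`. -/
def blockMartingale (m : ℕ → ℕ) (w : ℕ → ℝ) (n : ℕ) (x : Gm m) : ℂ :=
  ∑ b ∈ Finset.range n, (w b : ℂ) * (intervalKernel m (b + 1) x - intervalKernel m b x)

/-- The Vilenkin–Fourier coefficients of `blockMartingale`. -/
def blockCoef (m : ℕ → ℕ) (w : ℕ → ℝ) (i : ℕ) : ℂ :=
  ∑ b ∈ Finset.range (i + 1), (w b : ℂ) *
    ((if i < Mseq m (b + 1) then 1 else 0) - if i < Mseq m b then 1 else 0)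

lemma blockCoef_eq {m : ℕ → ℕ} (hm : ∀ k, 2 ≤ m k) (w : ℕ → ℝ) {i a : ℕ}
    (h : Mseq m a ≤ i) (h' : i < Mseq m (a + 1)) : blockCoef m w i = w a := by
  have ha : a ≤ i := ((Mseq_strictMono hm).id_le a).trans h
  rw [blockCoef, Finset.sum_eq_single a]
  · simp [h', show ¬ i < Mseq m a by omega]
  · intro b _ hb
    rcases lt_or_gt_of_ne hb with hb | hb
    · have h1 := (Mseq_strictMono hm).monotone (show b + 1 ≤ a by omega)
      have h2 := (Mseq_strictMono hm).monotone (show b ≤ a by omega)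
      simp [show ¬ i < Mseq m (b + 1) by omega, show ¬ i < Mseq m b by omega]
    · have h1 := (Mseq_strictMono hm).monotone (show a + 1 ≤ b + 1 by omega)
      have h2 := (Mseq_strictMono hm).monotone (show a + 1 ≤ b by omega)
      simp [show i < Mseq m (b + 1) by omega, show i < Mseq m b by omega]
  · intro hn
    exact absurd (Finset.mem_range.2 (by omega)) hn

lemma fourierCoefFn_blockMartingale {m : ℕ → ℕ} (hm : ∀ k, 2 ≤ m k) {μ : Measure (Gm m)}
    (hμ : IsHaarGm m μ) (w : ℕ → ℝ) {n i : ℕ} (h : i < n) :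
    fourierCoefFn m μ (blockMartingale m w n) i = blockCoef m w i := by
  have := hμ.isProbabilityMeasure
  have hint (b : ℕ) :
      Integrable (fun x => intervalKernel m b x * (starRingEnd ℂ) (psi m i x)) μ := by
    refine (integrable_intervalKernel hm b).mul_bdd (c := 1) ?_ (.of_forall fun x => ?_)
    · obtain ⟨N, hN⟩ : ∃ N, i < Mseq m N := ⟨i + 1, (Nat.lt_succ_self i).trans_le
        ((Mseq_strictMono hm).id_le (i + 1))⟩
      have hpsi : Measurable (psi m i) := by
        have : psi m i = fun x => ∏ k ∈ Finset.range N, rad m k x ^ digit m i k := by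
          ext x
          refine finprod_eq_prod_of_mulSupport_subset _ fun k hk => ?_
          by_contra hkN
          simp only [Finset.coe_range, Set.mem_Iio, not_lt] at hkN
          exact hk (by simp [digit_eq_zero hm hN hkN])
        rw [this]
        refine Finset.measurable_prod _ fun k _ => Measurable.pow_const ?_ _
        exact (Measurable.of_discrete (f := fun z : ZMod (m k) =>
          Complex.exp (2 * Real.pi * Complex.I * (z.val : ℂ) / (m k : ℂ)))).comp
          (measurable_pi_apply k)
      exact (Complex.continuous_conj.measurable.comp hpsi).aestronglyMeasurable
    · simp [norm_psi]
  have hsum : fourierCoefFn m μ (blockMartingale m w n) i =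
      ∑ b ∈ Finset.range n, (w b : ℂ) *
        ((if i < Mseq m (b + 1) then 1 else 0) - if i < Mseq m b then 1 else 0) := by
    have hterm (b : ℕ) : Integrable (fun x =>
        intervalKernel m (b + 1) x * (starRingEnd ℂ) (psi m i x) -
          intervalKernel m b x * (starRingEnd ℂ) (psi m i x)) μ := (hint (b + 1)).sub (hint b)
    simp only [fourierCoefFn, blockMartingale, Finset.sum_mul, mul_assoc, sub_mul]
    rw [integral_finsetSum _ fun b _ => (hterm b).const_mul _]
    refine Finset.sum_congr rfl fun b _ => ?_
    rw [integral_const_mul, integral_sub (hint _) (hint _), ← fourierCoefFn_intervalKernel hm hμ,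
      ← fourierCoefFn_intervalKernel hm hμ]
    rfl
  rw [hsum, blockCoef]
  symm
  refine Finset.sum_subset (Finset.range_subset_range.2 h) fun b _ hb => ?_
  have hb' : i + 1 ≤ b := by simpa using hb
  have h1 := (Mseq_strictMono hm).id_le b
  have h2 := (Mseq_strictMono hm).id_le (b + 1)
  simp only [id] at h1 h2
  simp [show i < Mseq m (b + 1) by omega, show i < Mseq m b by omega]

lemma integrable_blockMartingale {m : ℕ → ℕ} (hm : ∀ k, 2 ≤ m k) {μ : Measure (Gm m)}
    [IsFiniteMeasure μ] (w : ℕ → ℝ) (n : ℕ) : Integrable (blockMartingale m w n) μ :=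
  integrable_finsetSum _ fun b _ =>
    ((integrable_intervalKernel hm (b + 1)).sub (integrable_intervalKernel hm b)).const_mul _

lemma isVMartingale_blockMartingale {m : ℕ → ℕ} (hm : ∀ k, 2 ≤ m k) {μ : Measure (Gm m)}
    (hμ : IsHaarGm m μ) (w : ℕ → ℝ) : IsVMartingale m μ (blockMartingale m w) := by
  have := hμ.isProbabilityMeasure
  have hmeas (n : ℕ) : Measurable[filt m n] (blockMartingale m w n) := by
    refine @Finset.measurable_sum _ _ _ _ _ _ (filt m n) _ _ fun b hb => ?_
    rw [Finset.mem_range] at hb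
    exact ((measurable_filt_intervalKernel m hb).sub
      (measurable_filt_intervalKernel m hb.le)).const_mul _
  refine ⟨integrable_blockMartingale hm w, hmeas, fun n N hnN => ?_⟩
  refine (ae_eq_condExp_of_forall_setIntegral_eq (filt_le hm n) (integrable_blockMartingale hm w N)
    (fun s _ _ => (integrable_blockMartingale hm w n).integrableOn) (fun s hs _ => ?_)
    (hmeas n).stronglyMeasurable.aestronglyMeasurable).symm
  induction N, hnN using Nat.le_induction with
  | base => rfl
  | succ N hN ih =>
    have hI (b : ℕ) : IntegrableOn (intervalKernel m b) s μ :=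
      (integrable_intervalKernel hm b).integrableOn
    have hsucc : blockMartingale m w (N + 1) = fun x => blockMartingale m w N x +
        (w N : ℂ) * (intervalKernel m (N + 1) x - intervalKernel m N x) := by
      ext x
      simp [blockMartingale, Finset.sum_range_succ]
    have hterm : IntegrableOn (fun x =>
        (w N : ℂ) * (intervalKernel m (N + 1) x - intervalKernel m N x)) s μ :=
      ((hI _).sub (hI _)).const_mul _
    rw [hsucc, integral_add (integrable_blockMartingale hm w N).integrableOn hterm, ← ih, integral_const_mul, integral_sub (hI _) (hI _),
      setIntegral_intervalKernel hm hμ hN hs, setIntegral_intervalKernel hm hμ (by omega) hs]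
    simp

lemma enorm_block_le {m : ℕ → ℕ} (hm : ∀ k, 2 ≤ m k) {MM : ℕ} (hMM : ∀ k, m k ≤ MM)
    {w : ℝ} (hw : 0 ≤ w) (b : ℕ) (x : Gm m) :
    ‖(w : ℂ) * (intervalKernel m (b + 1) x - intervalKernel m b x)‖ₑ ≤
      (IsetO m b).indicator (fun _ => ENNReal.ofReal (w * (MM * Mseq m b))) x := by
  have hsub : IsetO m (b + 1) ⊆ IsetO m b := fun x hx k hk => hx k (by omega)
  have hle : (Mseq m b : ℝ) ≤ Mseq m (b + 1) := by
    exact_mod_cast (Mseq_strictMono hm).monotone b.le_succ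
  have hle' : (Mseq m (b + 1) : ℝ) ≤ MM * Mseq m b := by
    exact_mod_cast Nat.mul_le_mul_right (Mseq m b) (hMM b)
  have h0 : (0 : ℝ) ≤ Mseq m b := Nat.cast_nonneg _
  by_cases hx : x ∈ IsetO m b
  · rw [Set.indicator_of_mem hx, ← ofReal_norm]
    refine ENNReal.ofReal_le_ofReal ?_
    rw [norm_mul, Complex.norm_real, Real.norm_of_nonneg hw]
    refine mul_le_mul_of_nonneg_left ?_ hw
    by_cases hx' : x ∈ IsetO m (b + 1)
    · have : intervalKernel m (b + 1) x - intervalKernel m b x =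
          ((Mseq m (b + 1) - Mseq m b : ℝ) : ℂ) := by
        simp [intervalKernel, hx, hx']
      rw [this, Complex.norm_real, Real.norm_of_nonneg (by linarith)]
      linarith
    · have : intervalKernel m (b + 1) x - intervalKernel m b x = -((Mseq m b : ℝ) : ℂ) := by
        simp [intervalKernel, hx, hx']
      rw [this, norm_neg, Complex.norm_real, Real.norm_of_nonneg h0]
      linarith
  · have hx' : x ∉ IsetO m (b + 1) := fun h => hx (hsub h)
    simp [intervalKernel, hx, hx']

lemma _root_.ENNReal.sum_rpow_le_sum_rpow {ι : Type*} (s : Finset ι) (f : ι → ℝ≥0∞) {p : ℝ}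
    (hp : 0 < p) (hp1 : p ≤ 1) : (∑ i ∈ s, f i) ^ p ≤ ∑ i ∈ s, f i ^ p := by
  induction s using Finset.cons_induction with
  | empty => simp [hp]
  | cons a s ha ih =>
    rw [Finset.sum_cons, Finset.sum_cons]
    exact (ENNReal.rpow_add_le_add_rpow _ _ hp.le hp1).trans (by gcongr)

lemma memHp_blockMartingale {m : ℕ → ℕ} (hm : ∀ k, 2 ≤ m k) {MM : ℕ} (hMM : ∀ k, m k ≤ MM)
    {μ : Measure (Gm m)} (hμ : IsHaarGm m μ) {p : ℝ} (hp : 0 < p) (hp1 : p < 1)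
    {l : ℕ → ℝ} (hl : ∀ b, 0 ≤ l b) (hsum : Summable fun b => l b ^ p) :
    MemHp m μ p (blockMartingale m fun b => l b * (Mseq m b : ℝ) ^ (1 / p - 1)) := by
  set w : ℕ → ℝ := fun b => l b * (Mseq m b : ℝ) ^ (1 / p - 1) with hw
  have hw0 (b : ℕ) : 0 ≤ w b := mul_nonneg (hl b) (by positivity)
  let H (b : ℕ) (x : Gm m) : ℝ≥0∞ :=
    (IsetO m b).indicator (fun _ => ENNReal.ofReal (w b * (MM * Mseq m b)) ^ p) x
  have hpt (x : Gm m) : (⨆ n, (‖blockMartingale m w n x‖₊ : ℝ≥0∞)) ^ p ≤ ∑' b, H b x := by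
    rw [← ENNReal.le_rpow_inv_iff hp]
    refine iSup_le fun n => ?_
    rw [ENNReal.le_rpow_inv_iff hp]
    calc (‖blockMartingale m w n x‖₊ : ℝ≥0∞) ^ p
        ≤ (∑ b ∈ Finset.range n,
          ‖(w b : ℂ) * (intervalKernel m (b + 1) x - intervalKernel m b x)‖ₑ) ^ p :=
          ENNReal.rpow_le_rpow (enorm_sum_le _ _) hp.le
      _ ≤ ∑ b ∈ Finset.range n,
          ‖(w b : ℂ) * (intervalKernel m (b + 1) x - intervalKernel m b x)‖ₑ ^ p :=
          ENNReal.sum_rpow_le_sum_rpow _ _ hp hp1.le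
      _ ≤ ∑ b ∈ Finset.range n, H b x := by
          refine Finset.sum_le_sum fun b _ => ?_
          refine (ENNReal.rpow_le_rpow (enorm_block_le hm hMM (hw0 b) b x) hp.le).trans_eq ?_
          by_cases hx : x ∈ IsetO m b <;> simp [H, hx, hp]
      _ ≤ ∑' b, H b x := ENNReal.sum_le_tsum _
  have hH (b : ℕ) : ∫⁻ x, H b x ∂μ = ENNReal.ofReal ((MM : ℝ) ^ p * l b ^ p) := by
    have hM : (0 : ℝ) < Mseq m b := by exact_mod_cast Mseq_pos hm b
    have hreal : (w b * (MM * Mseq m b)) ^ p = ((MM : ℝ) ^ p * l b ^ p) * Mseq m b := by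
      have h1 : w b * (MM * Mseq m b) = MM * l b * (Mseq m b : ℝ) ^ (1 / p) := by
        rw [hw]
        simp only
        rw [Real.rpow_sub_one hM.ne']
        field_simp
      rw [h1, Real.mul_rpow (mul_nonneg (by positivity) (hl b)) (by positivity),
        Real.mul_rpow (by positivity) (hl b), ← Real.rpow_mul hM.le, one_div_mul_cancel hp.ne',
        Real.rpow_one]
    simp only [H]
    rw [lintegral_indicator (measurableSet_IsetO hm b), setLIntegral_const, IsetO, hμ b 0,
      ENNReal.ofReal_rpow_of_nonneg (mul_nonneg (hw0 b) (by positivity)) hp.le, hreal,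
      ENNReal.ofReal_mul (mul_nonneg (by positivity) (Real.rpow_nonneg (hl b) _)),
      ENNReal.ofReal_natCast, mul_assoc,
      ENNReal.mul_inv_cancel (by exact_mod_cast hM.ne') (by simp), mul_one]
  calc ∫⁻ x, (⨆ n, (‖blockMartingale m w n x‖₊ : ℝ≥0∞)) ^ p ∂μ
      ≤ ∫⁻ x, ∑' b, H b x ∂μ := lintegral_mono hpt
    _ = ∑' b, ∫⁻ x, H b x ∂μ := lintegral_tsum fun b =>
        (measurable_const.indicator (measurableSet_IsetO hm b)).aemeasurable
    _ = ∑' b, ENNReal.ofReal ((MM : ℝ) ^ p * l b ^ p) := by simp_rw [hH]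
    _ < ⊤ := (hsum.mul_left _).tsum_ofReal_lt_top

/-- A sequence tending to infinity has `p`-summable weights which do not compensate its growth,
even when squared. -/
lemma exists_summable_rpow_frequently_one_le {p : ℝ} (hp : 0 < p) {Ψ : ℕ → ℝ}
    (hΨ : Tendsto Ψ atTop atTop) :
    ∃ l : ℕ → ℝ, (∀ a, 0 ≤ l a) ∧ (∀ a, l a ≤ 1) ∧ (Summable fun a => l a ^ p) ∧
      ∃ᶠ a in atTop, 1 ≤ l a ^ 2 * Ψ a := by
  set q : ℝ := (1 / 2) ^ (1 / p) with hq
  have hq0 : 0 < q := by positivity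
  have hq1 : q ≤ 1 := Real.rpow_le_one (by norm_num) (by norm_num) (by positivity)
  have hqp : q ^ p = 1 / 2 := by
    rw [hq, ← Real.rpow_mul (by norm_num), one_div_mul_cancel hp.ne', Real.rpow_one]
  obtain ⟨α, hα, hαΨ⟩ : ∃ α : ℕ → ℕ, StrictMono α ∧ ∀ k, ((q ^ k) ^ 2)⁻¹ ≤ Ψ (α k) :=
    extraction_forall_of_eventually fun k => hΨ.eventually_ge_atTop _
  set l : ℕ → ℝ := Function.extend α (fun k => q ^ k) 0 with hl
  have hlα (k : ℕ) : l (α k) = q ^ k := hα.injective.extend_apply _ _ _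
  have hl' (a : ℕ) (ha : a ∉ Set.range α) : l a = 0 :=
    Function.extend_apply' _ _ _ fun ⟨k, hk⟩ => ha ⟨k, hk⟩
  refine ⟨l, fun a => ?_, fun a => ?_, ?_, ?_⟩
  · by_cases ha : a ∈ Set.range α
    · obtain ⟨k, rfl⟩ := ha
      rw [hlα]; positivity
    · rw [hl' a ha]
  · by_cases ha : a ∈ Set.range α
    · obtain ⟨k, rfl⟩ := ha
      rw [hlα]; exact pow_le_one₀ hq0.le hq1
    · rw [hl' a ha]; exact zero_le_one
  · rw [← hα.injective.summable_iff fun a ha => by rw [hl' a ha, Real.zero_rpow hp.ne']]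
    have : ((fun a => l a ^ p) ∘ α) = fun k => (1 / 2 : ℝ) ^ k := by
      ext k
      rw [Function.comp_apply, hlα, ← Real.rpow_natCast, ← Real.rpow_mul hq0.le, mul_comm,
        Real.rpow_mul hq0.le, hqp, Real.rpow_natCast]
    rw [this]
    exact summable_geometric_of_lt_one (by norm_num) (by norm_num)
  · refine frequently_atTop.2 fun N => ⟨α N, hα.id_le N, ?_⟩
    have h := hαΨ N
    have hpos : 0 < (q ^ N) ^ 2 := by positivity
    rw [hlα]
    calc (1 : ℝ) = (q ^ N) ^ 2 * ((q ^ N) ^ 2)⁻¹ := (mul_inv_cancel₀ hpos.ne').symm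
      _ ≤ _ := by gcongr

/-! ### Divergence of the three series -/

lemma _root_.ENNReal.tsum_eq_top_of_frequently_le {F : ℕ → ℝ≥0∞} {ε : ℝ≥0∞} (hε : ε ≠ 0)
    (h : ∃ᶠ a in atTop, ε ≤ F a) : ∑' a, F a = ⊤ := by
  by_contra hne
  have ht := ENNReal.tendsto_cofinite_zero_of_tsum_ne_top hne
  rw [Nat.cofinite_eq_atTop] at ht
  exact h ((ht.eventually (gt_mem_nhds (pos_iff_ne_zero.2 hε))).mono fun a ha => not_le.2 ha)

lemma tsum_sum_block_le {m : ℕ → ℕ} (hm : ∀ k, 2 ≤ m k) (V : ℕ → ℝ≥0∞) :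
    ∑' a, ∑ k ∈ Finset.Ico (Mseq m a) (Mseq m (a + 1)), V k ≤ ∑' k, V (k + 1) := by
  rw [ENNReal.tsum_eq_iSup_nat]
  refine iSup_le fun A => ?_
  have hblocks : ∑ a ∈ Finset.range A, ∑ k ∈ Finset.Ico (Mseq m a) (Mseq m (a + 1)), V k =
      ∑ k ∈ Finset.Ico 1 (Mseq m A), V k := by
    induction A with
    | zero => simp [Mseq]
    | succ A ih =>
      rw [Finset.sum_range_succ, ih, Finset.sum_Ico_consecutive _ (Mseq_pos hm A)
        ((Mseq_strictMono hm).monotone A.le_succ)]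
  rw [hblocks, Finset.sum_Ico_eq_sum_range]
  simp_rw [add_comm 1]
  exact ENNReal.sum_le_tsum _

lemma rpow_le_wLp_rpow_add {m : ℕ → ℕ} {μ : Measure (Gm m)} [IsProbabilityMeasure μ] {p : ℝ}
    (hp : 0 < p) {g h : Gm m → ℂ} {v : ℝ} (hv : 0 < v) (hgh : ∀ x, ‖h x - g x‖ = v) :
    ENNReal.ofReal ((v / 3) ^ p) ≤ wLp m μ p g ^ p + wLp m μ p h ^ p := by
  have hlow (u : Gm m → ℂ) :
      ENNReal.ofReal ((v / 3) ^ p) * μ {x | v / 3 < ‖u x‖} ≤ wLp m μ p u ^ p := by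
    have h1 : ENNReal.ofReal (v / 3) * μ {x | v / 3 < ‖u x‖} ^ (1 / p) ≤ wLp m μ p u :=
      le_iSup₂_of_le (v / 3) (by positivity) le_rfl
    refine le_trans (le_of_eq ?_) (ENNReal.rpow_le_rpow h1 hp.le)
    rw [ENNReal.mul_rpow_of_nonneg _ _ hp.le, ← ENNReal.rpow_mul, one_div_mul_cancel hp.ne',
      ENNReal.rpow_one, ENNReal.ofReal_rpow_of_nonneg (by positivity) hp.le]
  have hcover : (1 : ℝ≥0∞) ≤ μ {x | v / 3 < ‖g x‖} + μ {x | v / 3 < ‖h x‖} := by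
    rw [← measure_univ (μ := μ)]
    refine (measure_mono fun x _ => ?_).trans (measure_union_le _ _)
    by_contra hx
    have h1 : ‖g x‖ ≤ v / 3 := not_lt.1 fun hlt => hx (Or.inl hlt)
    have h2 : ‖h x‖ ≤ v / 3 := not_lt.1 fun hlt => hx (Or.inr hlt)
    have := norm_sub_le (h x) (g x)
    linarith [hgh x]
  calc ENNReal.ofReal ((v / 3) ^ p) = ENNReal.ofReal ((v / 3) ^ p) * 1 := (mul_one _).symm
    _ ≤ ENNReal.ofReal ((v / 3) ^ p) * (μ {x | v / 3 < ‖g x‖} + μ {x | v / 3 < ‖h x‖}) := by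
        gcongr
    _ ≤ _ := by
        rw [mul_add]
        exact add_le_add (hlow g) (hlow h)

/-- Divergence of the weighted series of Fourier coefficients forces divergence of the weighted
series of weak quasinorms of the partial sums, since consecutive partial sums differ by a
unimodular multiple of a coefficient. -/
lemma tsum_wLp_Spart_eq_top {m : ℕ → ℕ} {μ : Measure (Gm m)} [IsProbabilityMeasure μ] {p : ℝ}
    (hp : 0 < p) (hp2 : p < 2) {Φ : ℕ → ℝ} (hΦpos : ∀ n, 0 < Φ n) (hΦmono : Monotone Φ)
    {c : ℕ → ℂ}
    (hc : ∑' k : ℕ, ENNReal.ofReal (‖c (k + 1)‖ ^ p * Φ (k + 1) / ((k + 1 : ℝ) ^ (2 - p))) = ⊤) :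
    ∑' k : ℕ, wLp m μ p (Spart m c (k + 1)) ^ p * ENNReal.ofReal (Φ (k + 1)) /
      ENNReal.ofReal ((k + 1 : ℝ) ^ (2 - p)) = ⊤ := by
  set W : ℕ → ℝ≥0∞ := fun k => wLp m μ p (Spart m c (k + 1)) ^ p * ENNReal.ofReal (Φ (k + 1)) /
      ENNReal.ofReal ((k + 1 : ℝ) ^ (2 - p)) with hW
  set C : ℝ := (1 / 3) ^ p * ((2 : ℝ) ^ (2 - p))⁻¹ with hC
  have hC0 : 0 < C := by positivity
  have hstep (k : ℕ) : ENNReal.ofReal C *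
      ENNReal.ofReal (‖c (k + 1)‖ ^ p * Φ (k + 1) / ((k + 1 : ℝ) ^ (2 - p))) ≤
      W k + W (k + 1) := by
    rcases eq_or_lt_of_le (norm_nonneg (c (k + 1))) with h0 | h0
    · simp [← h0, hp.ne']
    have hgap := rpow_le_wLp_rpow_add (μ := μ) hp (g := Spart m c (k + 1))
      (h := Spart m c (k + 1 + 1)) h0 fun x => by
        simp [Spart, Finset.sum_range_succ _ (k + 1), norm_psi]
    set R : ℝ := Φ (k + 1) / (2 * (k + 1 : ℝ)) ^ (2 - p) with hR
    have hR' (j : ℕ) (hj : k ≤ j) (hj' : j ≤ k + 1) :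
        ENNReal.ofReal R ≤ ENNReal.ofReal (Φ (j + 1)) / ENNReal.ofReal ((j + 1 : ℝ) ^ (2 - p)) := by
      have h1 : (k : ℝ) ≤ j := by exact_mod_cast hj
      have h2 : (j : ℝ) ≤ k + 1 := by exact_mod_cast hj'
      have h3 : (0 : ℝ) ≤ k := Nat.cast_nonneg k
      rw [← ENNReal.ofReal_div_of_pos (by positivity)]
      refine ENNReal.ofReal_le_ofReal ?_
      refine div_le_div₀ (hΦpos _).le (hΦmono (by omega)) (by positivity) ?_
      exact Real.rpow_le_rpow (by positivity) (by linarith) (by linarith)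
    have hreal : C * (‖c (k + 1)‖ ^ p * Φ (k + 1) / ((k + 1 : ℝ) ^ (2 - p))) =
        (‖c (k + 1)‖ / 3) ^ p * R := by
      rw [hC, hR, Real.mul_rpow (by norm_num) (by positivity), div_eq_mul_one_div ‖c (k + 1)‖ 3,
        Real.mul_rpow h0.le (by norm_num)]
      field_simp
    rw [← ENNReal.ofReal_mul hC0.le, hreal, ENNReal.ofReal_mul (by positivity)]
    calc ENNReal.ofReal ((‖c (k + 1)‖ / 3) ^ p) * ENNReal.ofReal R
        ≤ (wLp m μ p (Spart m c (k + 1)) ^ p + wLp m μ p (Spart m c (k + 1 + 1)) ^ p) *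
          ENNReal.ofReal R := by gcongr
      _ ≤ W k + W (k + 1) := by
        rw [add_mul]
        simp only [hW, mul_div_assoc]
        exact add_le_add (mul_le_mul_right (hR' k le_rfl (by omega)) _)
          (mul_le_mul_right (hR' (k + 1) (by omega) le_rfl) _)
  have htop : (⊤ : ℝ≥0∞) ≤ ∑' k, W k + ∑' k, W (k + 1) := by
    rw [← ENNReal.tsum_add]
    refine le_trans (le_of_eq ?_) (ENNReal.tsum_le_tsum hstep)
    rw [ENNReal.tsum_mul_left, hc, ENNReal.mul_top (by simpa using hC0)]
  have hshift : ∑' k, W (k + 1) ≤ ∑' k, W k :=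
    ENNReal.tsum_comp_le_tsum_of_injective (add_left_injective 1) W
  rcases ENNReal.add_eq_top.1 (top_le_iff.1 htop) with h | h
  · exact h
  · exact top_le_iff.1 (h ▸ hshift)

lemma tsum_blockCoef_eq_top {m : ℕ → ℕ} (hm : ∀ k, 2 ≤ m k) {MM : ℕ} (hMM : ∀ k, m k ≤ MM)
    {p : ℝ} (hp : 0 < p) (hp2 : p < 2) {Φ : ℕ → ℝ} (hΦpos : ∀ n, 0 < Φ n) (hΦmono : Monotone Φ)
    {l : ℕ → ℝ} (hl : ∀ b, 0 ≤ l b) (hfreq : ∃ᶠ a in atTop, 1 ≤ l a ^ p * Φ (Mseq m a)) :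
    ∑' k : ℕ, ENNReal.ofReal
      (‖blockCoef m (fun b => l b * (Mseq m b : ℝ) ^ (1 / p - 1)) (k + 1)‖ ^ p * Φ (k + 1) /
        ((k + 1 : ℝ) ^ (2 - p))) = ⊤ := by
  set w : ℕ → ℝ := fun b => l b * (Mseq m b : ℝ) ^ (1 / p - 1) with hw
  have hMM0 : (0 : ℝ) < MM := by
    have := (hm 0).trans (hMM 0)
    exact_mod_cast (by omega : 0 < MM)
  have hblock (a : ℕ) (ha : 1 ≤ l a ^ p * Φ (Mseq m a)) :
      ENNReal.ofReal (((MM : ℝ) ^ (2 - p))⁻¹) ≤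
        ∑ k ∈ Finset.Ico (Mseq m a) (Mseq m (a + 1)),
          ENNReal.ofReal (‖blockCoef m w k‖ ^ p * Φ k / ((k : ℝ) ^ (2 - p))) := by
    have hM : (0 : ℝ) < Mseq m a := by exact_mod_cast Mseq_pos hm a
    have hcard : Mseq m a ≤ (Finset.Ico (Mseq m a) (Mseq m (a + 1))).card := by
      rw [Nat.card_Ico]
      have : 2 * Mseq m a ≤ Mseq m (a + 1) := Nat.mul_le_mul_right _ (hm a)
      omega
    have hwp : w a ^ p = l a ^ p * (Mseq m a : ℝ) ^ (1 - p) := by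
      rw [hw]
      simp only
      rw [Real.mul_rpow (hl a) (by positivity), ← Real.rpow_mul hM.le]
      congr 2
      field_simp
    have hterm : ∀ k ∈ Finset.Ico (Mseq m a) (Mseq m (a + 1)),
        ENNReal.ofReal ((Mseq m a : ℝ)⁻¹ * ((MM : ℝ) ^ (2 - p))⁻¹) ≤
          ENNReal.ofReal (‖blockCoef m w k‖ ^ p * Φ k / ((k : ℝ) ^ (2 - p))) := by
      intro k hk
      obtain ⟨hk1, hk2⟩ := Finset.mem_Ico.1 hk
      have hkM : (k : ℝ) ≤ MM * Mseq m a := by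
        exact_mod_cast hk2.le.trans (Nat.mul_le_mul_right (Mseq m a) (hMM a))
      have hk0 : (0 : ℝ) < k := by exact_mod_cast (Mseq_pos hm a).trans_le hk1
      refine ENNReal.ofReal_le_ofReal ?_
      rw [blockCoef_eq hm w hk1 hk2, Complex.norm_real,
        Real.norm_of_nonneg (mul_nonneg (hl a) (by positivity)), hwp]
      calc (Mseq m a : ℝ)⁻¹ * ((MM : ℝ) ^ (2 - p))⁻¹
          = 1 * (Mseq m a : ℝ) ^ (1 - p) / (MM * Mseq m a : ℝ) ^ (2 - p) := by
            rw [Real.mul_rpow hMM0.le hM.le, show 2 - p = (1 - p) + 1 by ring,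
              Real.rpow_add_one hM.ne']
            field_simp
        _ ≤ (l a ^ p * Φ (Mseq m a)) * (Mseq m a : ℝ) ^ (1 - p) /
            (MM * Mseq m a : ℝ) ^ (2 - p) := by gcongr
        _ ≤ (l a ^ p * Φ k) * (Mseq m a : ℝ) ^ (1 - p) / (k : ℝ) ^ (2 - p) := by
            have h1 := hΦmono hk1
            have h2 := Real.rpow_nonneg (hl a) p
            have h3 := (hΦpos k).le
            have h4 : (0 : ℝ) ≤ 2 - p := by linarith
            gcongr
        _ = _ := by ring
    refine le_trans ?_ (Finset.card_nsmul_le_sum _ _ _ hterm)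
    rw [nsmul_eq_mul, ← ENNReal.ofReal_natCast, ← ENNReal.ofReal_mul (by positivity)]
    refine ENNReal.ofReal_le_ofReal ?_
    calc ((MM : ℝ) ^ (2 - p))⁻¹
        = (Mseq m a : ℝ) * ((Mseq m a : ℝ)⁻¹ * ((MM : ℝ) ^ (2 - p))⁻¹) := by
          field_simp
      _ ≤ _ := by gcongr
  have h := tsum_sum_block_le hm
    fun k : ℕ => ENNReal.ofReal (‖blockCoef m w k‖ ^ p * Φ k / ((k : ℝ) ^ (2 - p)))
  rw [ENNReal.tsum_eq_top_of_frequently_le (ENNReal.ofReal_pos.2 (by positivity)).ne'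
    (hfreq.mono hblock), top_le_iff] at h
  simpa only [Nat.cast_add_one] using h

lemma tsum_sq_blockCoef_eq_top {m : ℕ → ℕ} (hm : ∀ k, 2 ≤ m k)
    {p : ℝ} {Φ : ℕ → ℝ} (hΦpos : ∀ n, 0 < Φ n)
    {l : ℕ → ℝ} (hfreq : ∃ᶠ a in atTop, 1 ≤ l a ^ 2 * Φ (Mseq m a)) :
    ∑' k : ℕ, ENNReal.ofReal (Φ (Mseq m (k + 1)) / (Mseq m (k + 1) : ℝ) ^ (2 / p - 2) *
      ∑ j ∈ Finset.Ico 1 (m (k + 1)),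
        ‖blockCoef m (fun b => l b * (Mseq m b : ℝ) ^ (1 / p - 1)) (j * Mseq m (k + 1))‖ ^ 2)
      = ⊤ := by
  have hfreq' : ∃ᶠ k in atTop, 1 ≤ l (k + 1) ^ 2 * Φ (Mseq m (k + 1)) := by
    rw [← map_add_atTop_eq_nat 1, frequently_map] at hfreq
    exact hfreq
  refine ENNReal.tsum_eq_top_of_frequently_le one_ne_zero (hfreq'.mono fun k hk => ?_)
  generalize k + 1 = a at hk
  have hM : (0 : ℝ) < Mseq m a := by exact_mod_cast Mseq_pos hm a
  rw [← ENNReal.ofReal_one]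
  refine ENNReal.ofReal_le_ofReal (hk.trans ?_)
  have hfirst : (l a * (Mseq m a : ℝ) ^ (1 / p - 1)) ^ 2 ≤ ∑ j ∈ Finset.Ico 1 (m a),
      ‖blockCoef m (fun b => l b * (Mseq m b : ℝ) ^ (1 / p - 1)) (j * Mseq m a)‖ ^ 2 := by
    refine le_trans (le_of_eq ?_) (Finset.single_le_sum (fun j _ => sq_nonneg _)
      (Finset.mem_Ico.2 ⟨le_rfl, hm a⟩))
    rw [one_mul, blockCoef_eq hm _ le_rfl (Mseq_strictMono hm a.lt_succ_self), Complex.norm_real,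
      Real.norm_eq_abs, sq_abs]
  have hpow : ((Mseq m a : ℝ) ^ (1 / p - 1)) ^ 2 = (Mseq m a : ℝ) ^ (2 / p - 2) := by
    rw [← Real.rpow_natCast, ← Real.rpow_mul hM.le]
    congr 1
    push_cast
    ring
  calc l a ^ 2 * Φ (Mseq m a)
      = Φ (Mseq m a) / (Mseq m a : ℝ) ^ (2 / p - 2) *
          (l a * (Mseq m a : ℝ) ^ (1 / p - 1)) ^ 2 := by
        rw [mul_pow, hpow]
        field_simp
    _ ≤ _ := mul_le_mul_of_nonneg_left hfirst (div_nonneg (hΦpos _).le (by positivity))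

theorem statement3 (m : ℕ → ℕ) (hm : ∀ k, 2 ≤ m k)
    (MM : ℕ) (hMM : IsLUB (Set.range m) MM)
    (μ : Measure (Gm m)) (hμ : IsHaarGm m μ)
    (p : ℝ) (hp0 : 0 < p) (hp1 : p < 1)
    (Φ : ℕ → ℝ) (hΦpos : ∀ n, 0 < Φ n) (hΦmono : Monotone Φ)
    (hΦtop : Tendsto Φ atTop atTop) :
    ∃ (f : ℕ → Gm m → ℂ) (c : ℕ → ℂ),
      IsVMartingale m μ f ∧ MemHp m μ p f ∧
      (∀ i, Tendsto (fun k => fourierCoefFn m μ (f k) i) atTop (nhds (c i))) ∧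
      ∑' k : ℕ, ENNReal.ofReal (‖c (k + 1)‖ ^ p * Φ (k + 1) / ((k + 1 : ℝ) ^ (2 - p))) = ⊤ ∧
      ∑' k : ℕ, ENNReal.ofReal (Φ (Mseq m (k + 1)) / (Mseq m (k + 1) : ℝ) ^ (2 / p - 2) *
        ∑ j ∈ Finset.Ico 1 (m (k + 1)), ‖c (j * Mseq m (k + 1))‖ ^ 2) = ⊤ ∧
      ∑' k : ℕ, wLp m μ p (Spart m c (k + 1)) ^ p * ENNReal.ofReal (Φ (k + 1)) /
        ENNReal.ofReal ((k + 1 : ℝ) ^ (2 - p)) = ⊤ := by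
  have hMM' (k : ℕ) : m k ≤ MM := hMM.1 ⟨k, rfl⟩
  have := hμ.isProbabilityMeasure
  obtain ⟨l, hl0, hl1, hsum, hfreq⟩ := exists_summable_rpow_frequently_one_le hp0
    (hΦtop.comp (Mseq_strictMono hm).tendsto_atTop)
  have hfreqp : ∃ᶠ a in atTop, 1 ≤ l a ^ p * Φ (Mseq m a) := by
    refine hfreq.mono fun a ha => ha.trans (mul_le_mul_of_nonneg_right ?_ (hΦpos _).le)
    rcases eq_or_lt_of_le (hl0 a) with h | h
    · simp [← h, hp0.ne']
    · rw [← Real.rpow_natCast]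
      exact Real.rpow_le_rpow_of_exponent_ge h (hl1 a) (by push_cast; linarith)
  have hfirst := tsum_blockCoef_eq_top hm hMM' hp0 (by linarith) hΦpos hΦmono hl0 hfreqp
  refine ⟨blockMartingale m fun b => l b * (Mseq m b : ℝ) ^ (1 / p - 1), blockCoef m _,
    isVMartingale_blockMartingale hm hμ _, memHp_blockMartingale hm hMM' hμ hp0 hp1 hl0 hsum,
    fun i => ?_, hfirst, tsum_sq_blockCoef_eq_top hm hΦpos hfreq,
    tsum_wLp_Spart_eq_top hp0 (by linarith) hΦpos hΦmono hfirst⟩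
  exact tendsto_const_nhds.congr' ((eventually_gt_atTop i).mono fun n hn =>
    (fourierCoefFn_blockMartingale hm hμ _ hn).symm)

end VilenkinPaper
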